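/- Let N = 2K for some K ∈ ℕ with K ≥ 1, and let an N-player game with payoffs f_i : (ℝ^n)^N → ℝ be a potential game with potential function φ. Then for every z ∈ (ℝ^n)^N, φ(z) = φ(0) + Σ_{i=1}^{2} [f_i(ẑ_i) − f_i(ẑ_{i−1})] + Σ_{i=2}^{K} h_{2i−1,2i}(z_{2i}, z_{2i−1}, 0, 0; ẑ_{2i−2}), where ẑ_m = (z_1,…,z_m,0,…,0) denotes the joint action agreeing with z in the first m blocks and zero elsewhere (in the last sum, ẑ_{2i−2} is used as the profile of the players other than 2i−1 and 2i). -/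

import Mathlib

noncomputable section

/-- `φ` is a potential function for the `N`-player game with payoffs `f i : (ℝ^n)^N → ℝ`:
for every player `i`, joint action `x` and deviation `x'_i`,
`f_i(x'_i, x_{-i}) - f_i(x_i, x_{-i}) = φ(x'_i, x_{-i}) - φ(x_i, x_{-i})`. -/
def PotentialFn {N n : ℕ} (f : Fin N → (Fin N → Fin n → ℝ) → ℝ)
    (φ : (Fin N → Fin n → ℝ) → ℝ) : Prop :=
  ∀ (i : Fin N) (x : Fin N → Fin n → ℝ) (x' : Fin n → ℝ),
    f i (Function.update x i x') - f i x = φ (Function.update x i x') - φ x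

/-- `pad y m` is the joint action `(y_1, …, y_m, 0, …, 0)` agreeing with `y` on the first
`m` blocks and vanishing elsewhere. -/
def pad {N n : ℕ} (y : Fin N → Fin n → ℝ) (m : ℕ) : Fin N → Fin n → ℝ :=
  fun k => if (k : ℕ) < m then y k else 0

/-- `hP f y z = Σ_{i=1}^N [f_i(z_1+y_1,…,z_i+y_i,z_{i+1},…,z_N)
                            - f_i(z_1+y_1,…,z_{i-1}+y_{i-1},z_i,…,z_N)]`. -/
def hP {N n : ℕ} (f : Fin N → (Fin N → Fin n → ℝ) → ℝ)
    (y z : Fin N → Fin n → ℝ) : ℝ :=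
  ∑ i : Fin N, (f i (z + pad y ((i : ℕ) + 1)) - f i (z + pad y (i : ℕ)))

/-- For distinct players `i, j` and a profile `w` of the remaining players' actions,
`hij f i j y_j y_i z_j z_i w
  = f_i⟨z_i+y_i, z_j⟩ - f_i⟨z_i, z_j⟩ + f_j⟨z_i+y_i, z_j+y_j⟩ - f_j⟨z_i+y_i, z_j⟩`,
where `⟨a, b⟩` is the joint action in which player `i` plays `a`, player `j` plays `b`, and
every other player `k` plays `w k`. -/
def hij {N n : ℕ} (f : Fin N → (Fin N → Fin n → ℝ) → ℝ) (i j : Fin N)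
    (yj yi zj zi : Fin n → ℝ) (w : Fin N → Fin n → ℝ) : ℝ :=
  f i (Function.update (Function.update w i (zi + yi)) j zj)
    - f i (Function.update (Function.update w i zi) j zj)
    + f j (Function.update (Function.update w i (zi + yi)) j (zj + yj))
    - f j (Function.update (Function.update w i (zi + yi)) j zj)

theorem pad_succ_aux {N n : ℕ} (z : Fin N → Fin n → ℝ) (m : ℕ) (hm : m < N) :
    pad z (m + 1) = Function.update (pad z m) ⟨m, hm⟩ (z ⟨m, hm⟩) := by
  funext k
  by_cases hk : k = ⟨m, hm⟩
  · subst hk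
    simp [pad]
  · have h1 : (k : ℕ) ≠ m := fun h => hk (Fin.ext h)
    rw [Function.update_of_ne hk]
    have h2 : (k : ℕ) < m + 1 ↔ (k : ℕ) < m := by omega
    simp only [pad, h2]

theorem pad_zero_aux {N n : ℕ} (z : Fin N → Fin n → ℝ) (m : ℕ) (j : Fin N) (hm : m ≤ j) :
    Function.update (pad z m) j 0 = pad z m := by
  have : pad z m j = 0 := by simp [pad, hm]
  rw [← this, Function.update_eq_self]

theorem pad_step_aux {N n : ℕ} (f : Fin N → (Fin N → Fin n → ℝ) → ℝ)
    (φ : (Fin N → Fin n → ℝ) → ℝ) (hpot : PotentialFn f φ)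
    (z : Fin N → Fin n → ℝ) (m : ℕ) (hm : m < N) :
    f ⟨m, hm⟩ (pad z (m + 1)) - f ⟨m, hm⟩ (pad z m) = φ (pad z (m + 1)) - φ (pad z m) := by
  rw [pad_succ_aux z m hm]
  exact hpot _ _ _

theorem hij_aux {N n : ℕ} (f : Fin N → (Fin N → Fin n → ℝ) → ℝ)
    (φ : (Fin N → Fin n → ℝ) → ℝ) (hpot : PotentialFn f φ)
    (z : Fin N → Fin n → ℝ) (m m' : ℕ) (hmm : m' = m + 1) (hm : m < N) (hm' : m' < N) :
    hij f ⟨m, hm⟩ ⟨m', hm'⟩ (z ⟨m', hm'⟩) (z ⟨m, hm⟩) 0 0 (pad z m)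
      = φ (pad z (m + 2)) - φ (pad z m) := by
  subst hmm
  have h1 := pad_step_aux f φ hpot z m hm
  have h2 := pad_step_aux f φ hpot z (m + 1) hm'
  unfold hij
  rw [zero_add, zero_add, ← pad_succ_aux z m hm, pad_zero_aux z m ⟨m, hm⟩ le_rfl,
    pad_zero_aux z m ⟨m + 1, hm'⟩ (Nat.le_succ m),
    pad_zero_aux z (m + 1) ⟨m + 1, hm'⟩ le_rfl, ← pad_succ_aux z (m + 1) hm']
  linarith

theorem tele_aux (g : ℕ → ℝ) (K : ℕ) (hK : 1 ≤ K) :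
    ∑ i ∈ Finset.Icc 2 K, (g (2 * i - 2 + 2) - g (2 * i - 2)) = g (2 * K) - g 2 := by
  induction K, hK using Nat.le_induction with
  | base => simp
  | succ k hk ih =>
    rw [Finset.sum_Icc_succ_top (by omega), ih]
    have h1 : 2 * (k + 1) - 2 = 2 * k := by omega
    rw [h1]
    have h2 : 2 * (k + 1) = 2 * k + 2 := by ring
    rw [h2]
    ring

/-- Let `N = 2K`, `K ≥ 1`, and let the game with payoffs `f` be a
potential game with potential function `φ`.  Then for every `z`,
`φ(z) = φ(0) + Σ_{i=1}^{2} [f_i(ẑ_i) - f_i(ẑ_{i-1})]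
       + Σ_{i=2}^{K} h_{2i-1,2i}(z_{2i}, z_{2i-1}, 0, 0; ẑ_{2i-2})`,
where `ẑ_m = (z_1,…,z_m,0,…,0)` (here `pad z m`). -/
theorem potential_decomposition_even {N n K : ℕ} (hK : 1 ≤ K) (hNK : N = 2 * K)
    (f : Fin N → (Fin N → Fin n → ℝ) → ℝ)
    (φ : (Fin N → Fin n → ℝ) → ℝ) (hpot : PotentialFn f φ) :
    ∀ z : Fin N → Fin n → ℝ,
      φ z = φ 0 +
        (∑ e ∈ (Finset.range 2).attach,
          (f ⟨e.1, by have := Finset.mem_range.mp e.2; omega⟩ (pad z (e.1 + 1)) -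
            f ⟨e.1, by have := Finset.mem_range.mp e.2; omega⟩ (pad z e.1))) +
        ∑ i ∈ (Finset.Icc 2 K).attach,
          hij f ⟨2 * i.1 - 2, by have := Finset.mem_Icc.mp i.2; omega⟩
            ⟨2 * i.1 - 1, by have := Finset.mem_Icc.mp i.2; omega⟩
            (z ⟨2 * i.1 - 1, by have := Finset.mem_Icc.mp i.2; omega⟩)
            (z ⟨2 * i.1 - 2, by have := Finset.mem_Icc.mp i.2; omega⟩) 0 0
            (pad z (2 * i.1 - 2)) := by
  intro z
  have e1 : (∑ e ∈ (Finset.range 2).attach,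
          (f ⟨e.1, by have := Finset.mem_range.mp e.2; omega⟩ (pad z (e.1 + 1)) -
            f ⟨e.1, by have := Finset.mem_range.mp e.2; omega⟩ (pad z e.1)))
      = ∑ e ∈ (Finset.range 2).attach, (φ (pad z (e.1 + 1)) - φ (pad z e.1)) :=
    Finset.sum_congr rfl fun e _ => pad_step_aux f φ hpot z e.1 _
  have e2 : (∑ i ∈ (Finset.Icc 2 K).attach,
          hij f ⟨2 * i.1 - 2, by have := Finset.mem_Icc.mp i.2; omega⟩
            ⟨2 * i.1 - 1, by have := Finset.mem_Icc.mp i.2; omega⟩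
            (z ⟨2 * i.1 - 1, by have := Finset.mem_Icc.mp i.2; omega⟩)
            (z ⟨2 * i.1 - 2, by have := Finset.mem_Icc.mp i.2; omega⟩) 0 0
            (pad z (2 * i.1 - 2)))
      = ∑ i ∈ (Finset.Icc 2 K).attach,
          (φ (pad z (2 * i.1 - 2 + 2)) - φ (pad z (2 * i.1 - 2))) :=
    Finset.sum_congr rfl fun i _ => hij_aux f φ hpot z _ _
      (by have := Finset.mem_Icc.mp i.2; omega) _ _
  rw [e1, e2, Finset.sum_attach (Finset.range 2) (fun e => φ (pad z (e + 1)) - φ (pad z e)),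
    Finset.sum_attach (Finset.Icc 2 K)
      (fun i => φ (pad z (2 * i - 2 + 2)) - φ (pad z (2 * i - 2))),
    tele_aux (fun m => φ (pad z m)) K hK, Finset.sum_range_succ, Finset.sum_range_one]
  have h0 : pad z 0 = 0 := by
    funext k
    simp [pad]
  have hN : pad z (2 * K) = z := by
    funext k
    have := k.2
    have h : (k : ℕ) < 2 * K := by omega
    simp [pad, h]
  simp only [h0, hN, zero_add, Nat.reduceAdd]
  ring
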